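/- Let d ≥ 2 and m ≥ 2, let j ≥ C(d+m−1, m−1) be an integer, and let b ∈ ℕ^{m+1} with |b| = dj. If b₀ ≤ l̃_j, then Δ_b is a cone over the vertex corresponding to one of the points (0,d,0,…,0), (0,0,d,0,…,0), …, (0,…,0,d) of 𝒜. -/

import Mathlib

open Finset

/-- Strict lexicographic order on vectors of natural numbers. -/
def LexLt {k : ℕ} (x y : Fin k → ℕ) : Prop :=
  ∃ t, (∀ s, s < t → x s = y s) ∧ x t < y t

/-- The simplicial complex `Δ_b`, given as the set of its faces. -/
def Delta {k : ℕ} (n : ℕ) (a : ℕ → Fin k → ℕ) (b : Fin k → ℕ) : Set (Finset ℕ) :=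
  {I | I ⊆ Finset.Icc 1 n ∧ ∀ t, ∑ i ∈ I, a i t ≤ b t}

/-- The collection `C_l` of subsets `σ ⊆ {1,…,n}` with `∑_{i∈σ} aⁱ₀ = l`. -/
def Cset {k : ℕ} (n : ℕ) (a : ℕ → Fin (k+1) → ℕ) (l : ℕ) : Finset (Finset ℕ) :=
  (Finset.Icc 1 n).powerset.filter (fun σ => ∑ i ∈ σ, a i 0 = l)

/-- `f_l = max_{σ ∈ C_l} ∑_{i∈σ} aⁱ₁`. -/
def fval {k : ℕ} (n : ℕ) (a : ℕ → Fin (k+1) → ℕ) (l : ℕ) : ℕ :=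
  (Cset n a l).sup (fun σ => ∑ i ∈ σ, a i 1)

section Antidiagonal

variable {ι : Type*} [Fintype ι] [DecidableEq ι] {d : ℕ}

/-- A set of lattice points missing some `p`-weight can be modified so that its `p`-weight grows
by one and its `q`-weight does not drop. -/
lemma exists_subset_piAntidiag_sum_succ {p q r : ι} (hqp : q ≠ p) (hrp : r ≠ p) (hqr : q ≠ r)
    {T : Finset (ι → ℕ)} (hT : T ⊆ piAntidiag univ d)
    (hlt : ∑ v ∈ T, v p < ∑ v ∈ piAntidiag univ d, v p) :
    ∃ T' ⊆ piAntidiag univ d,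
      ∑ v ∈ T', v p = ∑ v ∈ T, v p + 1 ∧ ∑ v ∈ T, v q ≤ ∑ v ∈ T', v q := by
  have hne : ((piAntidiag univ d \ T).filter (fun v : ι → ℕ => 0 < v p)).Nonempty := by
    by_contra h
    rw [not_nonempty_iff_eq_empty, filter_eq_empty_iff] at h
    have h0 : ∑ v ∈ piAntidiag univ d \ T, v p = 0 :=
      sum_eq_zero fun v hv => Nat.eq_zero_of_not_pos (h hv)
    have := sum_sdiff (f := fun v : ι → ℕ => v p) hT
    omega
  obtain ⟨x, hx, hmin⟩ := exists_min_image _ (fun v : ι → ℕ => v p) hne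
  simp only [mem_filter, mem_sdiff] at hx hmin
  obtain ⟨⟨hxV, hxT⟩, hxp⟩ := hx
  by_cases h1 : x p = 1
  · refine ⟨insert x T, insert_subset hxV hT, ?_, ?_⟩
    · rw [sum_insert hxT, h1, add_comm]
    · rw [sum_insert hxT]
      exact Nat.le_add_left _ _
  · let y : ι → ℕ := Function.update (Function.update x p (x p - 1)) r (x r + 1)
    have hyp : y p = x p - 1 := by simp [y, Function.update_of_ne hrp.symm]
    have hyq : y q = x q := by
      simp [y, Function.update_of_ne hqr, Function.update_of_ne hqp]
    have hyV : y ∈ piAntidiag univ d := by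
      have hx' : ∑ t, x t = d := (mem_piAntidiag.1 hxV).1
      refine mem_piAntidiag.2 ⟨?_, fun _ _ => mem_univ _⟩
      have e1 := sum_update_of_mem (mem_univ r) (Function.update x p (x p - 1)) (x r + 1)
      have e2 := sum_update_of_mem (mem_univ p) x (x p - 1)
      have e3 := sum_eq_add_sum_sdiff_singleton_of_mem (mem_univ p) x
      have e4 := sum_eq_add_sum_sdiff_singleton_of_mem (mem_univ r)
        (Function.update x p (x p - 1))
      rw [Function.update_of_ne hrp] at e4
      change ∑ t, y t = _ at e1
      change ∑ t, y t = d
      omega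
    have hyT : y ∈ T := by
      by_contra hy
      have := hmin y ⟨⟨hyV, hy⟩, by omega⟩
      omega
    have hx' : x ∉ T.erase y := fun h => hxT (mem_of_mem_erase h)
    refine ⟨insert x (T.erase y), insert_subset hxV ((erase_subset _ _).trans hT), ?_, ?_⟩
    · rw [sum_insert hx', ← add_sum_erase T (fun v => v p) hyT]
      omega
    · rw [sum_insert hx', ← add_sum_erase T (fun v => v q) hyT]
      omega

lemma exists_subset_piAntidiag_sum_eq {p q r : ι} (hqp : q ≠ p) (hrp : r ≠ p) (hqr : q ≠ r)
    {T : Finset (ι → ℕ)} (hT : T ⊆ piAntidiag univ d) {l : ℕ} (hl : ∑ v ∈ T, v p ≤ l)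
    (hlA : l ≤ ∑ v ∈ piAntidiag univ d, v p) :
    ∃ T' ⊆ piAntidiag univ d, ∑ v ∈ T', v p = l ∧ ∑ v ∈ T, v q ≤ ∑ v ∈ T', v q := by
  induction l, hl using Nat.le_induction with
  | base => exact ⟨T, hT, rfl, le_rfl⟩
  | succ l _ ih =>
    obtain ⟨T₁, hT₁, rfl, hq₁⟩ := ih (by omega)
    obtain ⟨T₂, hT₂, hp₂, hq₂⟩ :=
      exists_subset_piAntidiag_sum_succ hqp hrp hqr hT₁ (by omega)
    exact ⟨T₂, hT₂, hp₂, hq₁.trans hq₂⟩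

end Antidiagonal

lemma LexLt.ne {k : ℕ} {x y : Fin k → ℕ} (h : LexLt x y) : x ≠ y := by
  rintro rfl
  obtain ⟨t, -, ht⟩ := h
  exact ht.false

section Enumeration

variable {d m n : ℕ} {a : ℕ → Fin (m + 1) → ℕ}

/-- By symmetry in the coordinates other than `0`, `f_l` bounds all of their weights. -/
lemma sum_le_fval (himg : (Icc 1 n).image a = piAntidiag univ d)
    (hinj : Set.InjOn a (Icc 1 n)) {T : Finset (Fin (m + 1) → ℕ)} (hT : T ⊆ piAntidiag univ d)
    (h10 : (1 : Fin (m + 1)) ≠ 0) {s : Fin (m + 1)} (hs : s ≠ 0) :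
    ∑ v ∈ T, v s ≤ fval n a (∑ v ∈ T, v 0) := by
  let g : Fin (m + 1) ≃ Fin (m + 1) := Equiv.swap 1 s
  let T' : Finset (Fin (m + 1) → ℕ) := T.image (fun v => v ∘ g)
  have hT' : T' ⊆ (Icc 1 n).image a := by
    rw [himg]
    intro w hw
    obtain ⟨v, hv, rfl⟩ := mem_image.1 hw
    refine mem_piAntidiag.2 ⟨?_, fun _ _ => mem_univ _⟩
    exact (Equiv.sum_comp g v).trans (mem_piAntidiag.1 (hT hv)).1
  have hsum (t : Fin (m + 1)) : ∑ w ∈ T', w t = ∑ v ∈ T, v (g t) :=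
    sum_image fun _ _ _ _ h => g.surjective.injective_comp_right h
  obtain ⟨σ, hσ, hσT⟩ := subset_image_iff.1 hT'
  have hσsum (t : Fin (m + 1)) : ∑ i ∈ σ, a i t = ∑ v ∈ T, v (g t) := by
    rw [← hsum, ← hσT, sum_image (hinj.mono hσ)]
  have hmem : σ ∈ Cset n a (∑ v ∈ T, v 0) := by
    refine mem_filter.2 ⟨mem_powerset.2 (mod_cast hσ), ?_⟩
    rw [hσsum, Equiv.swap_apply_of_ne_of_ne h10.symm hs.symm]
  have := le_sup (f := fun σ => ∑ i ∈ σ, a i 1) hmem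
  simpa only [hσsum, g, Equiv.swap_apply_left, fval] using this

/-- The cone criterion: it needs an injective enumeration of the lattice points, in any order. -/
lemma exists_insert_mem_Delta (hm : 2 ≤ m) (himg : (Icc 1 n).image a = piAntidiag univ d)
    (hinj : Set.InjOn a (Icc 1 n)) {N l : ℕ} (hlA : l ≤ ∑ i ∈ Icc 1 n, a i 0)
    (hl : fval n a l ≤ (N - l + m - 1) / m) {b : Fin (m + 1) → ℕ} (hb : ∑ t, b t = N)
    (hb0 : b 0 ≤ l) :
    ∃ s : Fin (m + 1), 1 ≤ (s : ℕ) ∧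
      ∃ i ∈ Icc 1 n, (a i = fun t => if t = s then d else 0) ∧
        ∀ σ ∈ Delta n a b, insert i σ ∈ Delta n a b := by
  have : NeZero m := ⟨by omega⟩
  obtain ⟨u, -, hu⟩ := exists_max_image univ (fun u : Fin m => b u.succ) univ_nonempty
  have hbu : N ≤ b 0 + m * b u.succ := by
    rw [← hb, Fin.sum_univ_succ]
    have := sum_le_card_nsmul univ (fun u : Fin m => b u.succ) _ hu
    simpa using this
  have hs : u.succ ≠ 0 := Fin.succ_ne_zero u
  have hfb : fval n a l ≤ b u.succ := by
    refine hl.trans (Nat.le_of_lt_succ ((Nat.div_lt_iff_lt_mul (by omega)).2 ?_))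
    have : (b u.succ).succ * m = m * b u.succ + m := by rw [Nat.succ_mul, mul_comm]
    omega
  obtain ⟨i, hi, hai⟩ : ∃ i ∈ Icc 1 n, a i = fun t => if t = u.succ then d else 0 := by
    rw [← mem_image, himg]
    exact mem_piAntidiag.2 ⟨by simp, fun _ _ => mem_univ _⟩
  have hai_ne {t : Fin (m + 1)} (ht : t ≠ u.succ) : a i t = 0 := by rw [hai]; exact if_neg ht
  refine ⟨u.succ, by simp, i, hi, hai, fun σ hσ => ⟨insert_subset hi hσ.1, fun t => ?_⟩⟩
  by_cases hiσ : i ∈ σ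
  · rw [insert_eq_self.2 hiσ]
    exact hσ.2 t
  by_cases ht : t = u.succ
  · subst ht
    have hsub : insert i σ ⊆ Icc 1 n := insert_subset hi hσ.1
    have hsum (t : Fin (m + 1)) :
        ∑ v ∈ (insert i σ).image a, v t = ∑ i ∈ insert i σ, a i t :=
      sum_image (hinj.mono (mod_cast hsub))
    have h0 : ∑ v ∈ (insert i σ).image a, v 0 ≤ l := by
      rw [hsum, sum_insert hiσ, hai_ne hs.symm, zero_add]
      exact (hσ.2 0).trans hb0
    obtain ⟨r, hr0, hrs⟩ : ∃ r : Fin (m + 1), r ≠ 0 ∧ u.succ ≠ r := by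
      obtain ⟨r, hr⟩ : ∃ r, r ∉ ({0, u.succ} : Finset (Fin (m + 1))) := by
        by_contra! h
        have h1 := card_le_card (fun r _ => h r : univ ⊆ ({0, u.succ} : Finset (Fin (m + 1))))
        have h2 := card_le_two (a := (0 : Fin (m + 1))) (b := u.succ)
        simp only [card_univ, Fintype.card_fin] at h1
        omega
      simp only [mem_insert, mem_singleton, not_or] at hr
      exact ⟨r, hr.1, Ne.symm hr.2⟩
    obtain ⟨T, hT, rfl, hle⟩ := exists_subset_piAntidiag_sum_eq hs hr0 hrs
      (himg ▸ image_subset_image hsub) h0 (by rwa [← himg, sum_image hinj])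
    rw [← hsum]
    have h10 : (1 : Fin (m + 1)) ≠ 0 := by
      rw [Ne, Fin.ext_iff, Fin.val_one', Fin.val_zero, Nat.mod_eq_of_lt (by omega)]
      exact one_ne_zero
    exact (hle.trans (sum_le_fval himg hinj hT h10 hs)).trans hfb
  · rw [sum_insert hiσ, hai_ne ht, zero_add]
    exact hσ.2 t

end Enumeration

/-- (General `m`.) Let `j ≥ C(d+m-1,m-1)`, `|b| = d·j` and `b₀ ≤ l̃_j`
(the largest `l ∈ {0,…,A_j-1}` with `⌈(dj-l)/m⌉ ≥ f_l`, where
`⌈(dj-l)/m⌉ = (d·j - l + m - 1)/m` in natural-number division).  Then `Δ_b` is a cone over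
the vertex corresponding to one of the points `(0,d,0,…,0), (0,0,d,0,…,0), …, (0,…,0,d)`. -/
theorem vanishing_cone_low_b0_general
    (d : ℕ) (hd : 2 ≤ d) (m : ℕ) (hm : 2 ≤ m)
    (n : ℕ) (hn : n = (d + m).choose m)
    (a : ℕ → Fin (m + 1) → ℕ)
    (ha_sum : ∀ i ∈ Finset.Icc 1 n, ∑ t, a i t = d)
    (ha_lex : ∀ i₁ ∈ Finset.Icc 1 n, ∀ i₂ ∈ Finset.Icc 1 n, i₁ < i₂ → LexLt (a i₁) (a i₂))
    (ha_surj : ∀ v : Fin (m + 1) → ℕ, (∑ t, v t = d) → ∃ i ∈ Finset.Icc 1 n, a i = v)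
    (j : ℕ) (hj : (d + m - 1).choose (m - 1) ≤ j)
    (lt : ℕ)
    (hlt : IsGreatest
      {l | l < ∑ i ∈ Finset.Icc 1 (min j n), a i 0 ∧
        fval n a l ≤ (d * j - l + m - 1) / m} lt)
    (b : Fin (m + 1) → ℕ) (hb : ∑ t, b t = d * j) (hb0 : b 0 ≤ lt) :
    ∃ s : Fin (m + 1), 1 ≤ (s : ℕ) ∧
      ∃ i ∈ Finset.Icc 1 n, (a i = fun t => if t = s then d else 0) ∧
        ∀ σ ∈ Delta n a b, insert i σ ∈ Delta n a b := by
  have hinj : Set.InjOn a (Icc 1 n) := by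
    intro i₁ h₁ i₂ h₂ h
    by_contra hne
    rcases lt_or_gt_of_ne hne with hlt | hlt
    · exact (ha_lex i₁ h₁ i₂ h₂ hlt).ne h
    · exact (ha_lex i₂ h₂ i₁ h₁ hlt).ne h.symm
  have himg : (Icc 1 n).image a = piAntidiag univ d := by
    ext v
    refine ⟨fun hv => ?_, fun hv => mem_image.2 (ha_surj v (mem_piAntidiag.1 hv).1)⟩
    obtain ⟨i, hi, rfl⟩ := mem_image.1 hv
    exact mem_piAntidiag.2 ⟨ha_sum i hi, fun _ _ => mem_univ _⟩
  obtain ⟨hltA, hltf⟩ := hlt.1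
  exact exists_insert_mem_Delta hm himg hinj
    (hltA.le.trans (sum_le_sum_of_subset (Icc_subset_Icc_right (min_le_right j n))))
    hltf hb hb0
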